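/- Suppose T ∈ {C_e : e ∈ E} satisfies T − C0 > pa, ∑_{e: C_e > T} pd/(C_e−C0) < 1, and ∑_{e: C_e > T} pd/(C_e−C0) + ∑_{e: C_e = T} pd/(T−C0) > 1 (type II regime). Then in every Nash equilibrium of the normal-form game Γ, the defender's expected utility equals −T − pd·∑_{e: C_e > T} (C_e−T)/(C_e−C0) and the attacker's expected utility equals T − pa. -/

import Mathlib

open Finset

noncomputable section

namespace SecGame

variable {E : Type*} [Fintype E] [DecidableEq E]

/-- Usage cost after the attacker–defender interaction. -/
def usageCost (C0 : ℝ) (Ce : E → ℝ) (sd : Finset E) : Option E → ℝ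
  | some e => if e ∈ sd then C0 else Ce e
  | none => C0

/-- Defender mixed strategy over subsets of facilities. -/
def IsDefMixed (σd : Finset E → ℝ) : Prop :=
  (∀ sd, 0 ≤ σd sd) ∧ ∑ sd : Finset E, σd sd = 1

/-- Attacker mixed strategy over `E ∪ {∅}`. -/
def IsAtkMixed (σa : Option E → ℝ) : Prop :=
  (∀ sa, 0 ≤ σa sa) ∧ ∑ sa : Option E, σa sa = 1

/-- Defender expected utility. -/
def Ud (C0 : ℝ) (Ce : E → ℝ) (pd : ℝ) (σd : Finset E → ℝ) (σa : Option E → ℝ) : ℝ :=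
  ∑ sd : Finset E, ∑ sa : Option E,
    σd sd * σa sa * (-(usageCost C0 Ce sd sa) - pd * (sd.card : ℝ))

/-- Attacker expected utility. -/
def Ua (C0 : ℝ) (Ce : E → ℝ) (pa : ℝ) (σd : Finset E → ℝ) (σa : Option E → ℝ) : ℝ :=
  ∑ sd : Finset E, ∑ sa : Option E,
    σd sd * σa sa * (usageCost C0 Ce sd sa - pa * (if sa = none then 0 else 1))

/-- Security effort vector induced by a defender mixed strategy. -/
def effort (σd : Finset E → ℝ) (e : E) : ℝ :=
  ∑ sd ∈ Finset.univ.filter (fun sd => e ∈ sd), σd sd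

/-- Nash equilibrium of the normal form game Γ. -/
def IsNE (C0 : ℝ) (Ce : E → ℝ) (pa pd : ℝ) (σd : Finset E → ℝ) (σa : Option E → ℝ) : Prop :=
  IsDefMixed σd ∧ IsAtkMixed σa ∧
  (∀ σd', IsDefMixed σd' → Ud C0 Ce pd σd' σa ≤ Ud C0 Ce pd σd σa) ∧
  (∀ σa', IsAtkMixed σa' → Ua C0 Ce pa σd σa' ≤ Ua C0 Ce pa σd σa)

/-- Security effort vectors in the unit box `[0,1]^E`. -/
def InBox (ρ : E → ℝ) : Prop := ∀ e, 0 ≤ ρ e ∧ ρ e ≤ 1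

/-- Defender expected utility as a function of the security effort vector. -/
def UdRho (C0 : ℝ) (Ce : E → ℝ) (pd : ℝ) (ρ : E → ℝ) (σa : Option E → ℝ) : ℝ :=
  -(∑ e : E, (ρ e * ((C0 - Ce e) * σa (some e) + pd) + Ce e * σa (some e))) - C0 * σa none

/-- Attacker expected utility as a function of the security effort vector. -/
def UaRho (C0 : ℝ) (Ce : E → ℝ) (pa : ℝ) (ρ : E → ℝ) (σa : Option E → ℝ) : ℝ :=
  (∑ e : E, (ρ e * (C0 - Ce e) * σa (some e) + Ce e * σa (some e))) + C0 * σa none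
    - pa * ∑ e : E, σa (some e)

/-- Threshold security effort for a vulnerable facility. -/
def rhoHat (C0 : ℝ) (Ce : E → ℝ) (pa : ℝ) (e : E) : ℝ := (Ce e - pa - C0) / (Ce e - C0)

/-- Subgame perfect equilibrium of the sequential game Γ̃. -/
def IsSPE (C0 : ℝ) (Ce : E → ℝ) (pa pd : ℝ) (ρstar : E → ℝ)
    (σastar : (E → ℝ) → Option E → ℝ) : Prop :=
  InBox ρstar ∧
  (∀ ρ, InBox ρ → IsAtkMixed (σastar ρ) ∧
    ∀ σa, IsAtkMixed σa → UaRho C0 Ce pa ρ σa ≤ UaRho C0 Ce pa ρ (σastar ρ)) ∧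
  (∀ ρ, InBox ρ → UdRho C0 Ce pd ρ (σastar ρ) ≤ UdRho C0 Ce pd ρstar (σastar ρstar))

/-- The attacker's expected payoff of a pure action against the security effort vector `ρ`. -/
def atkPayoff (C0 : ℝ) (Ce : E → ℝ) (pa : ℝ) (ρ : E → ℝ) : Option E → ℝ
  | some e => Ce e - ρ e * (Ce e - C0) - pa
  | none => C0

lemma sum_mul_ite_mem (σd : Finset E → ℝ) (h : ∑ sd : Finset E, σd sd = 1) (e : E) (x y : ℝ) :
    ∑ sd : Finset E, σd sd * (if e ∈ sd then x else y) = y - effort σd e * (y - x) := by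
  have h1 : ∀ sd : Finset E, σd sd * (if e ∈ sd then x else y)
      = σd sd * y - (if e ∈ sd then σd sd else 0) * (y - x) := by
    intro sd
    split_ifs <;> ring
  simp only [h1, Finset.sum_sub_distrib, ← Finset.sum_mul, h, effort, Finset.sum_filter]
  ring

lemma sum_mul_card (σd : Finset E → ℝ) :
    ∑ sd : Finset E, σd sd * (sd.card : ℝ) = ∑ e : E, effort σd e := by
  simp only [effort, Finset.sum_filter]
  rw [Finset.sum_comm]
  refine Finset.sum_congr rfl fun sd _ => ?_
  rw [← Finset.sum_filter, Finset.sum_const]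
  simp [mul_comm]

lemma effort_nonneg {σd : Finset E → ℝ} (h : IsDefMixed σd) (e : E) : 0 ≤ effort σd e :=
  Finset.sum_nonneg fun sd _ => h.1 sd

lemma effort_le_one {σd : Finset E → ℝ} (h : IsDefMixed σd) (e : E) : effort σd e ≤ 1 := by
  rw [← h.2]
  exact Finset.sum_le_sum_of_subset_of_nonneg (Finset.filter_subset _ _) fun sd _ _ => h.1 sd

lemma Ua_eq_sum_atkPayoff (C0 : ℝ) (Ce : E → ℝ) (pa : ℝ) {σd : Finset E → ℝ}
    (h : IsDefMixed σd) (σa : Option E → ℝ) :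
    Ua C0 Ce pa σd σa = ∑ sa : Option E, σa sa * atkPayoff C0 Ce pa (effort σd) sa := by
  unfold Ua
  rw [Finset.sum_comm]
  refine Finset.sum_congr rfl fun sa _ => ?_
  have h1 : ∀ x : Finset E → ℝ, ∑ sd : Finset E, σd sd * σa sa * x sd
      = σa sa * ∑ sd : Finset E, σd sd * x sd := fun x => by
    rw [Finset.mul_sum]
    exact Finset.sum_congr rfl fun sd _ => by ring
  rw [h1]
  congr 1
  cases sa with
  | none => simp [usageCost, atkPayoff, ← Finset.sum_mul, h.2]
  | some e =>
    simp only [usageCost, atkPayoff, mul_sub, Finset.sum_sub_distrib, sum_mul_ite_mem σd h.2,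
      ← Finset.sum_mul, h.2]
    simp

lemma Ud_eq_UdRho (C0 : ℝ) (Ce : E → ℝ) (pd : ℝ) {σd : Finset E → ℝ} {σa : Option E → ℝ}
    (h : IsDefMixed σd) (ha : IsAtkMixed σa) :
    Ud C0 Ce pd σd σa = UdRho C0 Ce pd (effort σd) σa := by
  have h1 : Ud C0 Ce pd σd σa = -Ua C0 Ce 0 σd σa
      - pd * ∑ sd : Finset E, σd sd * (sd.card : ℝ) := by
    have h2 : ∀ sd : Finset E, σd sd * (sd.card : ℝ)
        = ∑ sa : Option E, σd sd * σa sa * (sd.card : ℝ) := fun sd => by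
      rw [← Finset.sum_mul, ← Finset.mul_sum, ha.2, mul_one]
    simp only [h2, Ud, Ua, Finset.mul_sum, ← Finset.sum_neg_distrib, ← Finset.sum_sub_distrib]
    exact Finset.sum_congr rfl fun sd _ => Finset.sum_congr rfl fun sa _ => by ring
  rw [h1, Ua_eq_sum_atkPayoff C0 Ce 0 h, sum_mul_card, Fintype.sum_option]
  simp only [atkPayoff, UdRho]
  rw [Finset.mul_sum, neg_add, ← Finset.sum_neg_distrib, ← Finset.sum_neg_distrib, add_sub_assoc,
    ← Finset.sum_sub_distrib, add_comm, sub_eq_add_neg, mul_comm]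
  congr 1
  exact Finset.sum_congr rfl fun e _ => by ring

lemma isDefMixed_single (s : Finset E) : IsDefMixed (Pi.single s (1 : ℝ)) :=
  ⟨fun sd => by by_cases hs : sd = s <;> simp [hs], by simp⟩

lemma effort_single (s : Finset E) (e : E) :
    effort (Pi.single s (1 : ℝ)) e = if e ∈ s then 1 else 0 := by
  simp [effort, Pi.single_apply, Finset.sum_ite_eq']

lemma isAtkMixed_single (a : Option E) : IsAtkMixed (Pi.single a (1 : ℝ)) :=
  ⟨fun sa => by by_cases hs : sa = a <;> simp [hs], by simp⟩

/-- At equilibrium the defender's effort is optimal at every facility. -/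
lemma IsNE.effort_mul_eq_max {C0 : ℝ} {Ce : E → ℝ} {pa pd : ℝ} {σd : Finset E → ℝ}
    {σa : Option E → ℝ} (h : IsNE C0 Ce pa pd σd σa) (e : E) :
    effort σd e * ((Ce e - C0) * σa (some e) - pd)
      = max ((Ce e - C0) * σa (some e) - pd) 0 := by
  obtain ⟨hd, ha, hdef, -⟩ := h
  set g : E → ℝ := fun e => (Ce e - C0) * σa (some e) - pd with hg
  have hle : ∀ e ∈ Finset.univ, effort σd e * g e ≤ max (g e) 0 := by
    intro e _
    have h0 := effort_nonneg hd e
    have h1 := effort_le_one hd e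
    rcases le_total (g e) 0 with hge | hge
    · rw [max_eq_right hge]
      exact mul_nonpos_of_nonneg_of_nonpos h0 hge
    · rw [max_eq_left hge]
      exact mul_le_of_le_one_left hge h1
  have hexp : ∀ ρ : E → ℝ, UdRho C0 Ce pd ρ σa
      = ∑ e, ρ e * g e - ∑ e, Ce e * σa (some e) - C0 * σa none := by
    intro ρ
    rw [UdRho, ← Finset.sum_neg_distrib, ← Finset.sum_sub_distrib]
    congr 1
    exact Finset.sum_congr rfl fun e _ => by simp only [hg]; ring
  have hdev := hdef _ (isDefMixed_single (Finset.univ.filter fun e => 0 < g e))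
  rw [Ud_eq_UdRho C0 Ce pd hd ha, Ud_eq_UdRho C0 Ce pd (isDefMixed_single _) ha, hexp, hexp]
    at hdev
  have hmax : ∀ e, effort (Pi.single (Finset.univ.filter fun e => 0 < g e) (1 : ℝ)) e * g e
      = max (g e) 0 := by
    intro e
    rw [effort_single]
    by_cases hge : 0 < g e
    · simp [hge, hge.le]
    · simp [hge, not_lt.mp hge]
  simp only [hmax] at hdev
  exact (Finset.sum_eq_sum_iff_of_le hle).mp
    (le_antisymm (Finset.sum_le_sum hle) (by linarith)) e (Finset.mem_univ e)

/-- At equilibrium no pure attack beats the attacker's equilibrium utility. -/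
lemma IsNE.atkPayoff_le {C0 : ℝ} {Ce : E → ℝ} {pa pd : ℝ} {σd : Finset E → ℝ}
    {σa : Option E → ℝ} (h : IsNE C0 Ce pa pd σd σa) (a : Option E) :
    atkPayoff C0 Ce pa (effort σd) a ≤ Ua C0 Ce pa σd σa := by
  have hdev := h.2.2.2 _ (isAtkMixed_single a)
  rw [Ua_eq_sum_atkPayoff C0 Ce pa h.1] at hdev
  simpa [Pi.single_apply] using hdev

/-- At equilibrium every action in the attacker's support attains the equilibrium utility. -/
lemma IsNE.atkPayoff_eq {C0 : ℝ} {Ce : E → ℝ} {pa pd : ℝ} {σd : Finset E → ℝ}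
    {σa : Option E → ℝ} (h : IsNE C0 Ce pa pd σd σa) {a : Option E} (ha : σa a ≠ 0) :
    atkPayoff C0 Ce pa (effort σd) a = Ua C0 Ce pa σd σa := by
  have hle : ∀ b ∈ Finset.univ, σa b * atkPayoff C0 Ce pa (effort σd) b
      ≤ σa b * Ua C0 Ce pa σd σa :=
    fun b _ => mul_le_mul_of_nonneg_left (h.atkPayoff_le b) (h.2.1.1 b)
  have heq : ∑ b, σa b * atkPayoff C0 Ce pa (effort σd) b = ∑ b, σa b * Ua C0 Ce pa σd σa := by
    rw [← Ua_eq_sum_atkPayoff C0 Ce pa h.1, ← Finset.sum_mul, h.2.1.2, one_mul]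
  exact mul_left_cancel₀ ha
    ((Finset.sum_eq_sum_iff_of_le hle).mp heq a (Finset.mem_univ a))

/-- **Proposition 3, type II regimes: Nash equilibrium utilities.**
Suppose `T ∈ {C_e : e ∈ E}` satisfies `T − C0 > pa`, `∑_{C_e>T} pd/(C_e−C0) < 1` and
`∑_{C_e>T} pd/(C_e−C0) + ∑_{C_e=T} pd/(T−C0) > 1`. Then in every Nash equilibrium of Γ,
the defender's utility is `−T − pd·∑_{C_e>T} (C_e−T)/(C_e−C0)` and the attacker's utility
is `T − pa`. -/
theorem NE_utilities_typeII {E : Type*} [Fintype E] [DecidableEq E] [Nonempty E]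
    (C0 : ℝ) (Ce : E → ℝ) (pa pd : ℝ) (hpa : 0 < pa) (hpd : 0 < pd)
    (T : ℝ) (hT : ∃ e : E, Ce e = T)
    (hvul : pa < T - C0)
    (hlt : ∑ e ∈ Finset.univ.filter (fun e => T < Ce e), pd / (Ce e - C0) < 1)
    (hgt : 1 < (∑ e ∈ Finset.univ.filter (fun e => T < Ce e), pd / (Ce e - C0))
      + ∑ e ∈ Finset.univ.filter (fun e => Ce e = T), pd / (T - C0)) :
    ∀ (σd : Finset E → ℝ) (σa : Option E → ℝ), IsNE C0 Ce pa pd σd σa →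
      Ud C0 Ce pd σd σa
        = -T - pd * ∑ e ∈ Finset.univ.filter (fun e => T < Ce e), (Ce e - T) / (Ce e - C0) ∧
      Ua C0 Ce pa σd σa = T - pa := by
  intro σd σa h
  have ha0 : ∀ a, 0 ≤ σa a := h.2.1.1
  have hsum := h.2.1.2
  rw [Fintype.sum_option] at hsum
  have hρ0 := effort_nonneg h.1
  have hρ1 := effort_le_one h.1
  have hbr := h.effort_mul_eq_max
  have hle : ∀ e, Ce e - effort σd e * (Ce e - C0) - pa ≤ Ua C0 Ce pa σd σa :=
    fun e => h.atkPayoff_le (some e)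
  have heq : ∀ e, σa (some e) ≠ 0 →
      Ce e - effort σd e * (Ce e - C0) - pa = Ua C0 Ce pa σd σa :=
    fun e he => h.atkPayoff_eq (a := some e) he
  have hnone : σa none ≠ 0 → C0 = Ua C0 Ce pa σd σa := fun h0 => h.atkPayoff_eq (a := none) h0
  have hg_nonneg : ∀ e, 0 < effort σd e → pd ≤ (Ce e - C0) * σa (some e) := by
    intro e he
    by_contra! hlt'
    have := hbr e
    rw [max_eq_right (by linarith)] at this
    exact absurd this (mul_neg_of_pos_of_neg he (by linarith)).ne
  have hg_nonpos : ∀ e, effort σd e < 1 → (Ce e - C0) * σa (some e) ≤ pd := by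
    intro e he
    by_contra! hlt'
    have := hbr e
    rw [max_eq_left (by linarith)] at this
    nlinarith
  have hpay_lt : ∀ e (x : ℝ), C0 < x → Ce e < x → Ce e - effort σd e * (Ce e - C0) < x := by
    intro e x hx hex
    have h0 := hρ0 e
    have h1 := hρ1 e
    rcases le_total C0 (Ce e) with hc | hc <;> nlinarith
  have hlow : T - pa ≤ Ua C0 Ce pa σd σa := by
    by_contra! hw
    have hbound : ∀ e, T ≤ Ce e → pd / (Ce e - C0) ≤ σa (some e) := by
      intro e he
      have hpos : 0 < Ce e - C0 := by linarith
      rw [div_le_iff₀ hpos, mul_comm]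
      refine hg_nonneg e ((hρ0 e).lt_of_ne fun h0 => ?_)
      have := hle e
      rw [← h0] at this
      linarith
    have hdisj : Disjoint (Finset.univ.filter fun e => T < Ce e)
        (Finset.univ.filter fun e => Ce e = T) :=
      Finset.disjoint_filter.mpr fun e _ h1 h2 => h1.ne' h2
    have h1 : ∑ e ∈ Finset.univ.filter (fun e => T < Ce e), pd / (Ce e - C0)
        ≤ ∑ e ∈ Finset.univ.filter (fun e => T < Ce e), σa (some e) :=
      Finset.sum_le_sum fun e he => hbound e (Finset.mem_filter.mp he).2.le
    have h2 : ∑ e ∈ Finset.univ.filter (fun e => Ce e = T), pd / (T - C0)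
        ≤ ∑ e ∈ Finset.univ.filter (fun e => Ce e = T), σa (some e) :=
      Finset.sum_le_sum fun e he => by
        have heT := (Finset.mem_filter.mp he).2
        have := hbound e heT.ge
        rwa [heT] at this
    have h3 := Finset.sum_union hdisj (f := fun e => σa (some e))
    have h4 := Finset.sum_le_univ_sum_of_nonneg (f := fun e => σa (some e))
      (s := (Finset.univ.filter fun e => T < Ce e) ∪ Finset.univ.filter fun e => Ce e = T)
      fun e => ha0 (some e)
    have := ha0 none
    linarith
  have hnone0 : σa none = 0 := by
    by_contra h0
    have := hnone h0
    linarith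
  have hhigh : Ua C0 Ce pa σd σa ≤ T - pa := by
    by_contra! hw
    have hzero : ∀ e, ¬ T < Ce e → σa (some e) = 0 := by
      intro e he
      by_contra h0
      have := heq e h0
      have := hpay_lt e (Ua C0 Ce pa σd σa + pa) (by linarith) (by linarith)
      linarith
    have hbound : ∀ e, T < Ce e → σa (some e) ≤ pd / (Ce e - C0) := by
      intro e he
      have hpos : 0 < Ce e - C0 := by linarith
      by_cases h0 : σa (some e) = 0
      · rw [h0]
        positivity
      rw [le_div_iff₀ hpos, mul_comm]
      refine hg_nonpos e ((hρ1 e).lt_of_ne fun h1 => ?_)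
      have := heq e h0
      rw [h1] at this
      linarith
    have h1 : ∑ e, σa (some e) = ∑ e ∈ Finset.univ.filter (fun e => T < Ce e), σa (some e) :=
      (Finset.sum_filter_of_ne fun e _ h0 => by
        by_contra hT'
        exact h0 (hzero e hT')).symm
    have h2 : ∑ e ∈ Finset.univ.filter (fun e => T < Ce e), σa (some e)
        ≤ ∑ e ∈ Finset.univ.filter (fun e => T < Ce e), pd / (Ce e - C0) :=
      Finset.sum_le_sum fun e he => hbound e (Finset.mem_filter.mp he).2
    linarith
  have hval : Ua C0 Ce pa σd σa = T - pa := le_antisymm hhigh hlow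
  refine ⟨?_, hval⟩
  rw [hval] at hle heq
  have hsupp : ∀ e, T < Ce e → (Ce e - C0) * σa (some e) = pd := by
    intro e he
    have hge : pd ≤ (Ce e - C0) * σa (some e) := hg_nonneg e <| (hρ0 e).lt_of_ne fun h0 => by
      have := hle e
      rw [← h0] at this
      linarith
    refine le_antisymm (hg_nonpos e ((hρ1 e).lt_of_ne fun h1 => ?_)) hge
    have hne : σa (some e) ≠ 0 := fun h0 => by
      rw [h0] at hge
      linarith
    have := heq e hne
    rw [h1] at this
    linarith
  have hbelow : ∀ e, Ce e < T → σa (some e) = 0 := by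
    intro e he
    by_contra h0
    have := heq e h0
    have := hpay_lt e T (by linarith) he
    linarith
  have hprod : ∀ e, effort σd e * ((Ce e - C0) * σa (some e) - pd) = 0 := by
    intro e
    rcases lt_trichotomy (Ce e) T with he | he | he
    · rw [hbr e, hbelow e he]
      exact max_eq_right (by linarith)
    · by_cases h0 : σa (some e) = 0
      · rw [hbr e, h0]
        exact max_eq_right (by linarith)
      · have := heq e h0
        have hz : effort σd e * (Ce e - C0) = 0 := by linarith
        rw [(mul_eq_zero.mp hz).resolve_right (by linarith), zero_mul]
    · rw [hsupp e he, sub_self, mul_zero]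
  have hterm : ∀ e, effort σd e * ((C0 - Ce e) * σa (some e) + pd) + Ce e * σa (some e)
      = T * σa (some e) + if T < Ce e then pd * ((Ce e - T) / (Ce e - C0)) else 0 := by
    intro e
    have h1 := hprod e
    have h2 : Ce e * σa (some e) = T * σa (some e)
        + if T < Ce e then pd * ((Ce e - T) / (Ce e - C0)) else 0 := by
      split_ifs with he
      · have hpos : Ce e - C0 ≠ 0 := by linarith
        rw [← hsupp e he]
        field_simp
        ring
      · rcases (not_lt.mp he).lt_or_eq with he' | he'
        · simp [hbelow e he']
        · simp [he']
    linarith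
  rw [Ud_eq_UdRho C0 Ce pd h.1 h.2.1, UdRho, hnone0]
  simp only [hterm]
  rw [Finset.sum_add_distrib, ← Finset.mul_sum, ← Finset.sum_filter, ← Finset.mul_sum]
  have : ∑ e, σa (some e) = 1 := by linarith
  rw [this]
  ring

end SecGame
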